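/- Let η : ℝ → ℝ be a smooth non-decreasing function with η(x) = 0 for x ≤ 0 and η(x) = 1 for x ≥ 1, let β > 0, ρ ∈ (0, 1), and let l ≥ 2 be an integer. Then there exist S and C > 0 (depending on n, l, ρ, β and η) such that for every s₀ ≥ S and all integers 0 ≤ i, j ≤ l: |∫₀^∞ η(e^{σ_l s₀} y − β) η(ρ e^{s₀/2} − y) (c_i φ_i(y)) (c_j φ_j(y)) w(y) dy − δ_{ij}| ≤ C e^{−(n − 1 + 2α) σ_l s₀}, and (∫₀^∞ (1 − η(e^{σ_l s₀} y − β) η(ρ e^{s₀/2} − y))² (c_i φ_i(y))² w(y) dy)^{1/2} ≤ C e^{−(n − 1 + 2α) σ_l s₀ / 2}, where δ_{ij} is the Kronecker delta. -/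

import Mathlib

open Set MeasureTheory

/-- The Kummer polynomial `M(-i, b; y² / 4)`, as a polynomial in `y`. -/
noncomputable def kummerPoly (b : ℝ) (i : ℕ) : Polynomial ℝ :=
  ∑ m ∈ Finset.range (i + 1),
    Polynomial.C ((-1 : ℝ) ^ m * (i.choose m : ℝ) / (4 ^ m * ∏ k ∈ Finset.range m, (b + (k : ℝ))))
      * Polynomial.X ^ (2 * m)

lemma kummerPoly_eval (b : ℝ) (i : ℕ) (y : ℝ) :
    (kummerPoly b i).eval y = ∑ m ∈ Finset.range (i + 1),
      (-1 : ℝ) ^ m * (i.choose m : ℝ) * (y ^ 2 / 4) ^ m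
        / ∏ k ∈ Finset.range m, (b + (k : ℝ)) := by
  simp only [kummerPoly, Polynomial.eval_finsetSum, Polynomial.eval_mul, Polynomial.eval_C,
    Polynomial.eval_pow, Polynomial.eval_X]
  refine Finset.sum_congr rfl fun m _ => ?_
  rw [div_pow, ← pow_mul, div_mul_eq_mul_div, mul_div_assoc', div_div]

lemma rpow_mul_pow_mul_exp_eq {b y : ℝ} (hy : 0 < y) (m : ℕ) :
    y ^ (2 * b - 1) * y ^ m * Real.exp (-y ^ 2 / 4)
      = y ^ (2 * b - 1 + m) * Real.exp (-(1 / 4) * y ^ 2) := by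
  rw [Real.rpow_add_natCast hy.ne', show -y ^ 2 / 4 = -(1 / 4) * y ^ 2 by ring]

lemma integrableOn_rpow_mul_pow_mul_exp {b : ℝ} (hb : 0 < b) (m : ℕ) :
    IntegrableOn (fun y : ℝ => y ^ (2 * b - 1) * y ^ m * Real.exp (-y ^ 2 / 4)) (Ioi 0) := by
  refine (integrableOn_rpow_mul_exp_neg_mul_sq (b := 1 / 4) (by norm_num)
    (s := 2 * b - 1 + m) ?_).congr_fun (fun y hy => (rpow_mul_pow_mul_exp_eq hy m).symm)
    measurableSet_Ioi
  have : (0 : ℝ) ≤ m := m.cast_nonneg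
  linarith

lemma integrableOn_rpow_mul_eval_mul_exp {b : ℝ} (hb : 0 < b) (Q : Polynomial ℝ) :
    IntegrableOn (fun y : ℝ => y ^ (2 * b - 1) * Q.eval y * Real.exp (-y ^ 2 / 4)) (Ioi 0) := by
  induction Q using Polynomial.induction_on' with
  | add p q hp hq =>
    refine (hp.add hq).congr_fun (fun y _ => ?_) measurableSet_Ioi
    simp only [Pi.add_apply, Polynomial.eval_add]
    ring
  | monomial m a =>
    refine IntegrableOn.congr_fun ((integrableOn_rpow_mul_pow_mul_exp hb m).const_mul a)
      (fun y _ => ?_) measurableSet_Ioi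
    simp only [Polynomial.eval_monomial]
    ring

lemma integral_rpow_mul_pow_mul_exp {b : ℝ} (hb : 0 < b) (m : ℕ) :
    ∫ y in Ioi (0 : ℝ), y ^ (2 * b - 1) * y ^ (2 * m) * Real.exp (-y ^ 2 / 4)
      = 4 ^ b / 2 * 4 ^ m * Real.Gamma (b + m) := by
  have hm : (0 : ℝ) ≤ m := m.cast_nonneg
  have h := integral_rpow_mul_exp_neg_mul_rpow (p := 2) (q := 2 * b - 1 + (2 * m : ℕ))
    (b := 1 / 4) two_pos (by push_cast; linarith) (by norm_num)
  rw [setIntegral_congr_fun measurableSet_Ioi (fun y hy => rpow_mul_pow_mul_exp_eq hy (2 * m))]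
  simp only [Real.rpow_two] at h
  rw [h, show (2 * b - 1 + ((2 * m : ℕ) : ℝ) + 1) / 2 = b + m by push_cast; ring,
    show -(2 * b - 1 + ((2 * m : ℕ) : ℝ) + 1) / 2 = -(b + m) by push_cast; ring,
    one_div, Real.inv_rpow (by norm_num), Real.rpow_neg (by norm_num), inv_inv,
    Real.rpow_add_natCast (by norm_num)]
  ring

lemma Gamma_add_natCast_eq_mul_prod {b : ℝ} (hb : 0 < b) (m : ℕ) :
    Real.Gamma (b + m) = Real.Gamma b * ∏ k ∈ Finset.range m, (b + (k : ℝ)) := by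
  induction m with
  | zero => simp
  | succ m ih =>
    rw [Finset.prod_range_succ, ← mul_assoc, ← ih, Nat.cast_succ, ← add_assoc,
      Real.Gamma_add_one (by positivity), mul_comm]

lemma sum_neg_one_pow_mul_choose_mul_eval_eq_zero {P : Polynomial ℝ} {i : ℕ}
    (hP : P.natDegree < i) :
    ∑ m ∈ Finset.range (i + 1), (-1 : ℝ) ^ m * (i.choose m : ℝ) * P.eval (m : ℝ) = 0 := by
  have h := congrFun (Polynomial.fwdDiff_iter_eq_zero_of_degree_lt hP) 0
  rw [fwdDiff_iter_eq_sum_shift] at h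
  have h2 : ∑ m ∈ Finset.range (i + 1), (-1 : ℝ) ^ m * (i.choose m : ℝ) * P.eval (m : ℝ)
      = (-1) ^ i * ∑ k ∈ Finset.range (i + 1),
        ((-1 : ℤ) ^ (i - k) * i.choose k) • P.eval ((0 : ℝ) + k • (1 : ℝ)) := by
    rw [Finset.mul_sum]
    refine Finset.sum_congr rfl fun m hm => ?_
    obtain ⟨d, rfl⟩ := Nat.exists_eq_add_of_le (Nat.lt_succ_iff.mp (Finset.mem_range.mp hm))
    have hd : ((-1 : ℝ) ^ d) * (-1) ^ d = 1 := by rw [← mul_pow]; simp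
    simp only [zsmul_eq_mul, nsmul_eq_mul, mul_one, zero_add, Nat.add_sub_cancel_left]
    push_cast
    linear_combination (-((-1 : ℝ) ^ m) * ((m + d).choose m : ℝ) * P.eval (m : ℝ)) * hd
  rw [h2, h]
  simp

lemma sum_neg_one_pow_mul_choose_mul_prod_eq_zero (b : ℝ) {i k : ℕ} (hk : k < i) :
    ∑ m ∈ Finset.range (i + 1), (-1 : ℝ) ^ m * (i.choose m : ℝ)
      * ∏ j ∈ Finset.range k, (b + m + (j : ℝ)) = 0 := by
  have hdeg : (∏ j ∈ Finset.range k, (Polynomial.X + Polynomial.C (b + (j : ℝ)))).natDegree < i := by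
    rw [Polynomial.natDegree_prod_of_monic _ _ fun j _ => Polynomial.monic_X_add_C _]
    simpa only [Polynomial.natDegree_X_add_C, Finset.sum_const, Finset.card_range, smul_eq_mul,
      mul_one] using hk
  convert sum_neg_one_pow_mul_choose_mul_eval_eq_zero hdeg using 4 with m _
  rw [Polynomial.eval_prod]
  refine Finset.prod_congr rfl fun j _ => ?_
  simp
  ring

lemma integral_kummerPoly_mul_pow_eq_zero {b : ℝ} (hb : 0 < b) {i k : ℕ} (hk : k < i) :
    ∫ y in Ioi (0 : ℝ), y ^ (2 * b - 1) * (kummerPoly b i * Polynomial.X ^ (2 * k)).eval y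
      * Real.exp (-y ^ 2 / 4) = 0 := by
  set c : ℕ → ℝ := fun m =>
    (-1 : ℝ) ^ m * (i.choose m : ℝ) / (4 ^ m * ∏ k ∈ Finset.range m, (b + (k : ℝ))) with hc
  have hexp : ∀ y : ℝ, y ^ (2 * b - 1) * (kummerPoly b i * Polynomial.X ^ (2 * k)).eval y
      * Real.exp (-y ^ 2 / 4) = ∑ m ∈ Finset.range (i + 1),
        c m * (y ^ (2 * b - 1) * y ^ (2 * (m + k)) * Real.exp (-y ^ 2 / 4)) := by
    intro y
    simp only [kummerPoly, Polynomial.eval_mul, Polynomial.eval_finsetSum, Polynomial.eval_C,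
      Polynomial.eval_pow, Polynomial.eval_X, Finset.mul_sum, Finset.sum_mul]
    refine Finset.sum_congr rfl fun m _ => ?_
    rw [mul_add, pow_add]
    ring
  simp_rw [hexp]
  rw [integral_finsetSum _ fun m _ => (integrableOn_rpow_mul_pow_mul_exp hb _).const_mul _]
  simp_rw [integral_const_mul, integral_rpow_mul_pow_mul_exp hb]
  rw [← mul_zero (4 ^ b / 2 * 4 ^ k * Real.Gamma b),
    ← sum_neg_one_pow_mul_choose_mul_prod_eq_zero b hk, Finset.mul_sum]
  refine Finset.sum_congr rfl fun m _ => ?_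
  have hprod : ∏ k ∈ Finset.range m, (b + (k : ℝ)) ≠ 0 :=
    Finset.prod_ne_zero_iff.mpr fun k _ => by positivity
  rw [Gamma_add_natCast_eq_mul_prod hb, Finset.prod_range_add, hc]
  simp only [Nat.cast_add, ← add_assoc, pow_add]
  field_simp

lemma integral_kummerPoly_mul_kummerPoly_eq_zero_of_lt {b : ℝ} (hb : 0 < b) {i j : ℕ} (h : j < i) :
    ∫ y in Ioi (0 : ℝ), y ^ (2 * b - 1) * (kummerPoly b i * kummerPoly b j).eval y
      * Real.exp (-y ^ 2 / 4) = 0 := by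
  set c : ℕ → ℝ := fun m =>
    (-1 : ℝ) ^ m * (j.choose m : ℝ) / (4 ^ m * ∏ k ∈ Finset.range m, (b + (k : ℝ))) with hc
  have hexp : ∀ y : ℝ, y ^ (2 * b - 1) * (kummerPoly b i * kummerPoly b j).eval y
      * Real.exp (-y ^ 2 / 4) = ∑ m ∈ Finset.range (j + 1),
        c m * (y ^ (2 * b - 1) * (kummerPoly b i * Polynomial.X ^ (2 * m)).eval y
          * Real.exp (-y ^ 2 / 4)) := by
    intro y
    rw [kummerPoly.eq_1 b j]
    simp only [Polynomial.eval_mul, Polynomial.eval_finsetSum, Polynomial.eval_C,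
      Polynomial.eval_pow, Polynomial.eval_X, Finset.mul_sum, Finset.sum_mul]
    refine Finset.sum_congr rfl fun m _ => ?_
    ring
  simp_rw [hexp]
  rw [integral_finsetSum _ fun m _ => (integrableOn_rpow_mul_eval_mul_exp hb _).const_mul _]
  refine Finset.sum_eq_zero fun m hm => ?_
  rw [integral_const_mul,
    integral_kummerPoly_mul_pow_eq_zero hb ((Nat.lt_succ_iff.mp (Finset.mem_range.mp hm)).trans_lt h),
    mul_zero]

lemma integral_kummerPoly_mul_kummerPoly_eq_zero {b : ℝ} (hb : 0 < b) {i j : ℕ} (h : i ≠ j) :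
    ∫ y in Ioi (0 : ℝ), y ^ (2 * b - 1) * (kummerPoly b i * kummerPoly b j).eval y
      * Real.exp (-y ^ 2 / 4) = 0 := by
  rcases lt_or_gt_of_ne h with h | h
  · rw [mul_comm (kummerPoly b i)]
    exact integral_kummerPoly_mul_kummerPoly_eq_zero_of_lt hb h
  · exact integral_kummerPoly_mul_kummerPoly_eq_zero_of_lt hb h

/-- A function of the form `y ^ (2b - 1) Q(y) e^{-y² / 4}` has mass `O(e^{-2bσs})` on the region
where the cut-off `η(e^{σs} y - β) η(ρ e^{s/2} - y)` differs from `1`. -/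
lemma exists_integral_cutoff_le {b : ℝ} (hb : 0 < b) (Q : Polynomial ℝ) (σ : ℝ) {β ρ : ℝ}
    (hβ : 0 < β) (hρ : 0 < ρ) (hσ : 0 ≤ σ) :
    ∃ C : ℝ, 0 ≤ C ∧ ∀ s : ℝ, 0 ≤ s → ∀ h : ℝ → ℝ, (∀ y, 0 ≤ h y) → (∀ y, h y ≤ 1) →
      (∀ y, h y ≠ 0 → Real.exp (σ * s) * y ≤ 1 + β ∨ ρ * Real.exp (s / 2) ≤ y + 1) →
      ∫ y in Ioi (0 : ℝ), h y * |y ^ (2 * b - 1) * Q.eval y * Real.exp (-y ^ 2 / 4)|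
        ≤ C * Real.exp (-(2 * b) * σ * s) := by
  obtain ⟨N, hN⟩ := exists_nat_ge (4 * b * σ)
  obtain ⟨M, hM⟩ := (isCompact_Icc (a := (0 : ℝ)) (b := 1 + β)).exists_bound_of_continuousOn
    (f := fun y => Q.eval y * Real.exp (-y ^ 2 / 4)) (by fun_prop)
  have hM0 : 0 ≤ M := (norm_nonneg _).trans (hM 0 ⟨le_rfl, by positivity⟩)
  set G : ℝ → ℝ := fun y => |y ^ (2 * b - 1) * Q.eval y * Real.exp (-y ^ 2 / 4)| with hG
  set T : ℝ → ℝ := fun y => ((y + 1) / ρ) ^ N * G y with hT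
  have hTint : IntegrableOn T (Ioi 0) := by
    refine IntegrableOn.congr_fun
      (integrableOn_rpow_mul_eval_mul_exp hb
        ((Polynomial.C (1 / ρ) * (Polynomial.X + 1)) ^ N * Q)).norm
      (fun y hy => ?_) measurableSet_Ioi
    have hy' : 0 < y := hy
    have h1 : 0 ≤ ((y + 1) / ρ) ^ N := by positivity
    simp only [hT, hG]
    rw [Real.norm_eq_abs, show ((y + 1) / ρ) ^ N = |((y + 1) / ρ) ^ N| from (abs_of_nonneg h1).symm, ← abs_mul]
    congr 1
    simp
    ring
  have hT0 : 0 ≤ ∫ y in Ioi (0 : ℝ), T y := by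
    refine setIntegral_nonneg measurableSet_Ioi fun y hy => ?_
    have hy' : 0 < y := hy
    positivity
  refine ⟨M * (1 + β) ^ (2 * b) / (2 * b) + ∫ y in Ioi (0 : ℝ), T y, by positivity, ?_⟩
  intro s hs h h0 h1 hsupp
  set δ : ℝ := (1 + β) * Real.exp (-(σ * s)) with hδ
  have hδ0 : 0 < δ := by positivity
  have hδle : δ ≤ 1 + β := by
    have : Real.exp (-(σ * s)) ≤ 1 := Real.exp_le_one_iff.mpr (by nlinarith)
    nlinarith
  set A : ℝ → ℝ := (Ioc 0 δ).indicator fun y => M * y ^ (2 * b - 1) with hA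
  have hpow : IntegrableOn (fun y : ℝ => M * y ^ (2 * b - 1)) (Ioc 0 δ) :=
    ((intervalIntegrable_iff_integrableOn_Ioc_of_le hδ0.le).mp
      (intervalIntegral.intervalIntegrable_rpow' (by linarith))).const_mul M
  have hAint : IntegrableOn A (Ioi 0) :=
    ((integrable_indicator_iff measurableSet_Ioc).mpr hpow).integrableOn
  have hAval : ∫ y in Ioi (0 : ℝ), A y
      = M * (1 + β) ^ (2 * b) / (2 * b) * Real.exp (-(2 * b) * σ * s) := by
    rw [hA, setIntegral_indicator measurableSet_Ioc,
      inter_eq_self_of_subset_right Ioc_subset_Ioi_self, integral_const_mul,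
      ← intervalIntegral.integral_of_le hδ0.le, integral_rpow (Or.inl (by linarith)),
      sub_add_cancel, Real.zero_rpow (by positivity), hδ,
      Real.mul_rpow (by positivity) (Real.exp_pos _).le, ← Real.exp_mul]
    ring_nf
  have hle : ∀ y ∈ Ioi (0 : ℝ), h y * G y ≤ A y + Real.exp (-(2 * b) * σ * s) * T y := by
    intro y hy
    have hy' : 0 < y := hy
    have hG0 : 0 ≤ G y := abs_nonneg _
    have hT0 : 0 ≤ T y := by positivity
    have hA0 : 0 ≤ A y := indicator_nonneg (fun z hz => by
      have := hz.1
      positivity) y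
    have hle1 : h y * G y ≤ G y := mul_le_of_le_one_left hG0 (h1 y)
    by_cases hz : h y = 0
    · rw [hz, zero_mul]
      positivity
    rcases hsupp y hz with hy1 | hy1
    · have hyδ : y ≤ δ := by
        rw [hδ, Real.exp_neg, ← div_eq_mul_inv, le_div_iff₀ (Real.exp_pos _), mul_comm]
        exact hy1
      have hGA : G y ≤ A y := by
        rw [hA, indicator_of_mem (show y ∈ Ioc 0 δ from ⟨hy', hyδ⟩), hG]
        simp only
        rw [mul_assoc, abs_mul, abs_of_pos (Real.rpow_pos_of_pos hy' _), mul_comm]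
        exact mul_le_mul_of_nonneg_right (hM y ⟨hy'.le, hyδ.trans hδle⟩)
          (Real.rpow_pos_of_pos hy' _).le
      have : 0 ≤ Real.exp (-(2 * b) * σ * s) * T y := by positivity
      linarith
    · have hone : 1 ≤ Real.exp (-(2 * b) * σ * s) * ((y + 1) / ρ) ^ N := by
        have hbase : Real.exp (s / 2) ≤ (y + 1) / ρ := by
          rw [le_div_iff₀ hρ, mul_comm]
          exact hy1
        have hpowle := pow_le_pow_left₀ (Real.exp_pos _).le hbase N
        rw [← Real.exp_nat_mul] at hpowle
        calc (1 : ℝ) ≤ Real.exp (-(2 * b) * σ * s) * Real.exp (N * (s / 2)) := by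
              rw [← Real.exp_add, Real.one_le_exp_iff]
              nlinarith
          _ ≤ _ := by gcongr
      have : G y ≤ Real.exp (-(2 * b) * σ * s) * T y := by
        rw [hT]
        simp only
        rw [← mul_assoc]
        exact le_mul_of_one_le_left hG0 hone
      linarith
  calc ∫ y in Ioi (0 : ℝ), h y * G y
      ≤ ∫ y in Ioi (0 : ℝ), (A y + Real.exp (-(2 * b) * σ * s) * T y) := by
        refine integral_mono_of_nonneg
          (Filter.Eventually.of_forall fun y => mul_nonneg (h0 y) (abs_nonneg _))
          (hAint.add (hTint.const_mul _)) ?_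
        exact (ae_restrict_iff' measurableSet_Ioi).mpr (Filter.Eventually.of_forall hle)
    _ = _ := by
        rw [integral_add hAint (hTint.const_mul _), integral_const_mul, hAval]
        ring



/-- the cut-off family `η(e^{σ_l s₀} y − β) η(ρ e^{s₀/2} − y)` almost preserves
the orthonormality of the normalized eigenfunctions `c_i φ_i` in the weighted `L²` space,
with errors of size `e^{−(n−1+2α) σ_l s₀}` and `e^{−(n−1+2α) σ_l s₀ / 2}` respectively,
for all `s₀` sufficiently large. -/
theorem stmt_6 (n : ℕ) (hn : 8 ≤ n)
    (α b : ℝ)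
    (hα : α = (3 - (n : ℝ) + Real.sqrt ((n : ℝ) ^ 2 - 10 * (n : ℝ) + 17)) / 2)
    (hb : b = α + ((n : ℝ) - 1) / 2)
    (l : ℕ) (hl : 2 ≤ l)
    (lamₗ σₗ : ℝ) (hlamₗ : lamₗ = -(1 - α) / 2 + (l : ℝ)) (hσ : σₗ = lamₗ / (1 - α))
    (φ : ℕ → ℝ → ℝ)
    (hφ : ∀ (i : ℕ) (y : ℝ), φ i y = y ^ α * ∑ m ∈ Finset.range (i + 1),
      (-1 : ℝ) ^ m * (i.choose m : ℝ) * (y ^ 2 / 4) ^ m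
        / ∏ k ∈ Finset.range m, (b + (k : ℝ)))
    (w : ℝ → ℝ)
    (hw : ∀ y : ℝ, w y = y ^ ((n : ℝ) - 2) * Real.exp (-y ^ 2 / 4))
    (η : ℝ → ℝ) (hηsm : ContDiff ℝ (⊤ : ℕ∞) η) (hηmono : Monotone η)
    (hη0 : ∀ x : ℝ, x ≤ 0 → η x = 0) (hη1 : ∀ x : ℝ, 1 ≤ x → η x = 1)
    (β ρ : ℝ) (hβ : 0 < β) (hρ : ρ ∈ Ioo (0 : ℝ) 1) :
    ∃ S C : ℝ, 0 < C ∧ ∀ s₀ : ℝ, S ≤ s₀ → ∀ i : ℕ, i ≤ l → ∀ j : ℕ, j ≤ l →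
      ∀ ci cj : ℝ, 0 < ci → 0 < cj →
      (∫ y in Ioi (0 : ℝ), (ci * φ i y) ^ 2 * w y) = 1 →
      (∫ y in Ioi (0 : ℝ), (cj * φ j y) ^ 2 * w y) = 1 →
      |(∫ y in Ioi (0 : ℝ), η (Real.exp (σₗ * s₀) * y - β) * η (ρ * Real.exp (s₀ / 2) - y)
            * (ci * φ i y) * (cj * φ j y) * w y)
          - (if i = j then (1 : ℝ) else 0)|
        ≤ C * Real.exp (-((n : ℝ) - 1 + 2 * α) * σₗ * s₀) ∧
      Real.sqrt (∫ y in Ioi (0 : ℝ),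
            (1 - η (Real.exp (σₗ * s₀) * y - β) * η (ρ * Real.exp (s₀ / 2) - y)) ^ 2
              * (ci * φ i y) ^ 2 * w y)
        ≤ C * Real.exp (-((n : ℝ) - 1 + 2 * α) * σₗ * s₀ / 2) := by
  have hn' : (8 : ℝ) ≤ n := by exact_mod_cast hn
  have hl' : (2 : ℝ) ≤ l := by exact_mod_cast hl
  set r := Real.sqrt ((n : ℝ) ^ 2 - 10 * (n : ℝ) + 17)
  have hr0 : 0 ≤ r := Real.sqrt_nonneg _
  have hrle : r ≤ n - 5 := Real.sqrt_le_iff.mpr ⟨by linarith, by nlinarith⟩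
  have hrge : (n : ℝ) - 9 ≤ r := (le_abs_self _).trans (Real.abs_le_sqrt (by nlinarith))
  have hb0 : 0 < b := by rw [hb, hα]; linarith
  have hσ0 : 0 ≤ σₗ := by
    rw [hσ, hlamₗ]
    exact div_nonneg (by linarith) (by linarith)
  have h2b : (n : ℝ) - 1 + 2 * α = 2 * b := by rw [hb]; ring
  have hηnn : ∀ x, 0 ≤ η x := fun x => by
    rcases le_total x 0 with h | h
    · exact (hη0 x h).ge
    · exact (hη0 0 le_rfl).ge.trans (hηmono h)
  have hηle : ∀ x, η x ≤ 1 := fun x => by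
    rcases le_total 1 x with h | h
    · exact (hη1 x h).le
    · exact (hηmono h).trans (hη1 1 le_rfl).le
  set F : ℕ → ℕ → ℝ → ℝ := fun i j y =>
    y ^ (2 * b - 1) * (kummerPoly b i * kummerPoly b j).eval y * Real.exp (-y ^ 2 / 4) with hF
  have hφF : ∀ i j, ∀ y ∈ Ioi (0 : ℝ), φ i y * φ j y * w y = F i j y := by
    intro i j y hy
    have hy' : 0 < y := hy
    rw [hφ, hφ, hw, ← kummerPoly_eval, ← kummerPoly_eval, hF]
    simp only [Polynomial.eval_mul]
    rw [show 2 * b - 1 = α + α + ((n : ℝ) - 2) by rw [hb]; ring, Real.rpow_add hy',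
      Real.rpow_add hy']
    ring
  have hFint : ∀ i j, IntegrableOn (F i j) (Ioi 0) := fun i j =>
    integrableOn_rpow_mul_eval_mul_exp hb0 _
  choose B hB0 hB using fun i j : ℕ =>
    exists_integral_cutoff_le hb0 (kummerPoly b i * kummerPoly b j) σₗ hβ hρ.1 hσ0
  set K : ℕ → ℝ := fun i => Real.sqrt (∫ y in Ioi (0 : ℝ), F i i y)⁻¹ with hK
  have hnorm : ∀ i : ℕ, ∀ c : ℝ, 0 < c → (∫ y in Ioi (0 : ℝ), (c * φ i y) ^ 2 * w y) = 1 →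
      c = K i ∧ c * c * ∫ y in Ioi (0 : ℝ), F i i y = 1 := by
    intro i c hc h
    have h1 : c * c * ∫ y in Ioi (0 : ℝ), F i i y = 1 := by
      rw [← integral_const_mul, ← h]
      refine setIntegral_congr_fun measurableSet_Ioi fun y hy => ?_
      rw [← hφF i i y hy]
      ring
    refine ⟨?_, h1⟩
    simp only [hK]
    rw [← eq_inv_of_mul_eq_one_left h1, Real.sqrt_mul_self hc.le]
  have hterm : ∀ i j, 0 ≤ K i * K j * B i j := fun i j =>
    mul_nonneg (mul_nonneg (Real.sqrt_nonneg _) (Real.sqrt_nonneg _)) (hB0 i j)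
  set C : ℝ := 1 + ∑ i ∈ Finset.range (l + 1), ∑ j ∈ Finset.range (l + 1), K i * K j * B i j
    with hC
  have hCle : ∀ i ≤ l, ∀ j ≤ l, K i * K j * B i j ≤ C := by
    intro i hi j hj
    have h1 := Finset.single_le_sum (f := fun j => K i * K j * B i j) (fun j _ => hterm i j)
      (Finset.mem_range.mpr (Nat.lt_succ_of_le hj))
    have h2 := Finset.single_le_sum
      (f := fun i => ∑ j ∈ Finset.range (l + 1), K i * K j * B i j)
      (fun i _ => Finset.sum_nonneg fun j _ => hterm i j)
      (Finset.mem_range.mpr (Nat.lt_succ_of_le hi))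
    linarith
  have hC1 : 1 ≤ C := by
    have : 0 ≤ ∑ i ∈ Finset.range (l + 1), ∑ j ∈ Finset.range (l + 1), K i * K j * B i j :=
      Finset.sum_nonneg fun i _ => Finset.sum_nonneg fun j _ => hterm i j
    linarith
  refine ⟨0, C, by linarith, ?_⟩
  intro s₀ hs i hi j hj ci cj hci hcj hIi hIj
  obtain ⟨hciK, hcii⟩ := hnorm i ci hci hIi
  obtain ⟨hcjK, -⟩ := hnorm j cj hcj hIj
  rw [h2b]
  set χ : ℝ → ℝ := fun y => η (Real.exp (σₗ * s₀) * y - β) * η (ρ * Real.exp (s₀ / 2) - y)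
    with hχ
  have hχ0 : ∀ y, 0 ≤ χ y := fun y => mul_nonneg (hηnn _) (hηnn _)
  have hχ1 : ∀ y, χ y ≤ 1 := fun y => mul_le_one₀ (hηle _) (hηnn _) (hηle _)
  have hχc : Continuous χ := by
    have := hηsm.continuous
    fun_prop
  have hsupp : ∀ y, χ y ≠ 1 →
      Real.exp (σₗ * s₀) * y ≤ 1 + β ∨ ρ * Real.exp (s₀ / 2) ≤ y + 1 := by
    intro y hy
    by_contra! hcon
    refine hy ?_
    simp only [hχ]
    rw [hη1 _ (by linarith [hcon.1]), hη1 _ (by linarith [hcon.2]), one_mul]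
  have hχF : IntegrableOn (fun y => χ y * F i j y) (Ioi 0) :=
    (hFint i j).bdd_mul (c := 1) hχc.aestronglyMeasurable
      (Filter.Eventually.of_forall fun y => by
        rw [Real.norm_eq_abs, abs_of_nonneg (hχ0 y)]
        exact hχ1 y)
  constructor
  · have horth : ci * cj * ∫ y in Ioi (0 : ℝ), F i j y = if i = j then 1 else 0 := by
      split_ifs with hij
      · subst hij
        rw [hcjK, ← hciK, hcii]
      · rw [integral_kummerPoly_mul_kummerPoly_eq_zero hb0 hij, mul_zero]
    have hint : (∫ y in Ioi (0 : ℝ), η (Real.exp (σₗ * s₀) * y - β)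
          * η (ρ * Real.exp (s₀ / 2) - y) * (ci * φ i y) * (cj * φ j y) * w y)
        = ci * cj * ∫ y in Ioi (0 : ℝ), χ y * F i j y := by
      rw [← integral_const_mul]
      refine setIntegral_congr_fun measurableSet_Ioi fun y hy => ?_
      rw [← hφF i j y hy]
      ring
    have hdiff : ∫ y in Ioi (0 : ℝ), (1 - χ y) * F i j y
        = (∫ y in Ioi (0 : ℝ), F i j y) - ∫ y in Ioi (0 : ℝ), χ y * F i j y := by
      rw [← integral_sub (hFint i j) hχF]
      simp only [sub_mul, one_mul]
    rw [hint, ← horth, ← mul_sub, abs_mul, abs_of_pos (mul_pos hci hcj), abs_sub_comm, ← hdiff]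
    have habs : |∫ y in Ioi (0 : ℝ), (1 - χ y) * F i j y|
        ≤ B i j * Real.exp (-(2 * b) * σₗ * s₀) := by
      refine abs_integral_le_integral_abs.trans ?_
      simp only [abs_mul (1 - χ _), abs_of_nonneg (sub_nonneg.mpr (hχ1 _))]
      exact hB i j s₀ hs (fun y => 1 - χ y) (fun y => sub_nonneg.mpr (hχ1 y))
        (fun y => sub_le_self _ (hχ0 y)) fun y hy => hsupp y fun h => hy (by rw [h, sub_self])
    calc ci * cj * |∫ y in Ioi (0 : ℝ), (1 - χ y) * F i j y|
        ≤ ci * cj * (B i j * Real.exp (-(2 * b) * σₗ * s₀)) := by gcongr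
      _ = K i * K j * B i j * Real.exp (-(2 * b) * σₗ * s₀) := by rw [← hciK, ← hcjK]; ring
      _ ≤ _ := by gcongr; exact hCle i hi j hj
  · have hint : (∫ y in Ioi (0 : ℝ), (1 - η (Real.exp (σₗ * s₀) * y - β)
          * η (ρ * Real.exp (s₀ / 2) - y)) ^ 2 * (ci * φ i y) ^ 2 * w y)
        = ci * ci * ∫ y in Ioi (0 : ℝ), (1 - χ y) ^ 2 * |F i i y| := by
      rw [← integral_const_mul]
      refine setIntegral_congr_fun measurableSet_Ioi fun y hy => ?_
      have hy' : 0 < y := hy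
      have hFnn : 0 ≤ F i i y := by
        simp only [hF, Polynomial.eval_mul]
        exact mul_nonneg (mul_nonneg (by positivity) (mul_self_nonneg _)) (Real.exp_pos _).le
      rw [abs_of_nonneg hFnn, ← hφF i i y hy]
      ring
    have hbound : ∫ y in Ioi (0 : ℝ), (1 - χ y) ^ 2 * |F i i y|
        ≤ B i i * Real.exp (-(2 * b) * σₗ * s₀) :=
      hB i i s₀ hs (fun y => (1 - χ y) ^ 2) (fun y => sq_nonneg _)
        (fun y => pow_le_one₀ (sub_nonneg.mpr (hχ1 y)) (sub_le_self _ (hχ0 y)))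
        fun y hy => hsupp y fun h => hy (by simp [h])
    rw [hint]
    refine Real.sqrt_le_iff.mpr ⟨mul_nonneg (zero_le_one.trans hC1) (Real.exp_pos _).le, ?_⟩
    rw [mul_pow, ← Real.exp_nat_mul,
      show ((2 : ℕ) : ℝ) * (-(2 * b) * σₗ * s₀ / 2) = -(2 * b) * σₗ * s₀ by push_cast; ring]
    calc ci * ci * ∫ y in Ioi (0 : ℝ), (1 - χ y) ^ 2 * |F i i y|
        ≤ ci * ci * (B i i * Real.exp (-(2 * b) * σₗ * s₀)) := by gcongr
      _ = K i * K i * B i i * Real.exp (-(2 * b) * σₗ * s₀) := by rw [← hciK]; ring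
      _ ≤ _ := by
        gcongr
        exact (hCle i hi i hi).trans (le_self_pow₀ hC1 two_ne_zero)
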